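/- arXiv:1012.4137 — 2 statements merged into one kernel-verified Lean document; each statement's English description precedes it below -/
import Mathlib

section
/- The complete bipartite graph K_{2,3} has no straight-line embedding in the plane whose edges have at most 2 distinct slopes; that is, every non-crossing straight-line drawing of K_{2,3} uses at least 3 distinct edge slopes. -/
/-- The slope of the segment between two points of the plane, as an angle in
`(-π/2, π/2]`, with `0` horizontal and `π/2` vertical. -/
noncomputable def lineSlope (p q : ℝ × ℝ) : ℝ :=
  if p.1 = q.1 then Real.pi / 2 else Real.arctan ((q.2 - p.2) / (q.1 - p.1))

/-- `f` is a straight-line (non-crossing) embedding of `G`, where the vertices of `G`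
are the elements of `V`. -/
def IsSLEmbeddingOn {α : Type*} (V : Set α) (G : SimpleGraph α) (f : α → ℝ × ℝ) : Prop :=
  Set.InjOn f V ∧
  (∀ u v, G.Adj u v → ∀ w ∈ V, f w ∈ segment ℝ (f u) (f v) → w = u ∨ w = v) ∧
  (∀ u v x y, G.Adj u v → G.Adj x y → Sym2.mk (u, v) ≠ Sym2.mk (x, y) →
    ∀ p, p ∈ segment ℝ (f u) (f v) → p ∈ segment ℝ (f x) (f y) →
      ∃ w, (w = u ∨ w = v) ∧ (w = x ∨ w = y) ∧ p = f w)

theorem lineSlope_comm (p q : ℝ × ℝ) : lineSlope p q = lineSlope q p := by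
  unfold lineSlope
  by_cases h : p.1 = q.1
  · simp [h]
  · rw [if_neg h, if_neg (Ne.symm h), ← neg_sub p.2 q.2, ← neg_sub p.1 q.1, neg_div_neg_eq]

theorem lineSlope_eq_iff {p q r : ℝ × ℝ} :
    lineSlope p q = lineSlope p r ↔
      (p.1 = q.1 ∧ p.1 = r.1) ∨ (p.1 ≠ q.1 ∧ p.1 ≠ r.1 ∧
        (q.2 - p.2) / (q.1 - p.1) = (r.2 - p.2) / (r.1 - p.1)) := by
  unfold lineSlope
  split_ifs with h h' h'
  · simp [← h, h']
  · simp [← h, h', (Real.arctan_lt_pi_div_two _).ne']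
  · simp [h, ← h', (Real.arctan_lt_pi_div_two _).ne]
  · simp [h, h', Real.arctan_injective.eq_iff]

/-- If two segments from `p` have the same slope, so does the segment joining their ends. -/
theorem lineSlope_eq_of_lineSlope_eq {p q r : ℝ × ℝ} (hqr : q ≠ r)
    (h : lineSlope p q = lineSlope p r) : lineSlope q r = lineSlope p q := by
  rw [lineSlope_comm p q, lineSlope_eq_iff]
  rcases lineSlope_eq_iff.1 h with ⟨h₁, h₂⟩ | ⟨h₁, h₂, h₃⟩
  · exact .inl ⟨h₁.symm.trans h₂, h₁.symm⟩
  · have hq : q.1 - p.1 ≠ 0 := sub_ne_zero.2 h₁.symm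
    have hr : r.1 - p.1 ≠ 0 := sub_ne_zero.2 h₂.symm
    have hpq : p.1 - q.1 ≠ 0 := sub_ne_zero.2 h₁
    rw [div_eq_div_iff hq hr] at h₃
    have hne : q.1 ≠ r.1 := fun e ↦ hqr <| Prod.ext e <| by
      rw [e] at h₃ hq
      linarith [mul_right_cancel₀ hr h₃]
    refine .inr ⟨hne, h₁.symm, ?_⟩
    rw [div_eq_div_iff (sub_ne_zero.2 hne.symm) hpq]
    linarith

theorem collinear_of_lineSlope_eq {p q r : ℝ × ℝ} (hpq : p ≠ q)
    (h : lineSlope p q = lineSlope p r) : Collinear ℝ {p, q, r} := by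
  rw [collinear_iff_of_mem (p₀ := p) (by simp)]
  refine ⟨q - p, ?_⟩
  have key : ∃ t : ℝ, r = t • (q - p) + p := by
    rcases lineSlope_eq_iff.1 h with ⟨h₁, h₂⟩ | ⟨h₁, h₂, h₃⟩
    · have hq : q.2 - p.2 ≠ 0 := sub_ne_zero.2 fun e ↦ hpq (Prod.ext h₁ e.symm)
      refine ⟨(r.2 - p.2) / (q.2 - p.2), Prod.ext ?_ ?_⟩
      · simp [← h₁, ← h₂]
      · simp [hq]
    · have hq : q.1 - p.1 ≠ 0 := sub_ne_zero.2 h₁.symm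
      have hr : r.1 - p.1 ≠ 0 := sub_ne_zero.2 h₂.symm
      refine ⟨(r.1 - p.1) / (q.1 - p.1), Prod.ext ?_ ?_⟩
      · simp [hq]
      · rw [div_eq_div_iff hq hr] at h₃
        simp only [Prod.snd_add, Prod.smul_snd, Prod.snd_sub, smul_eq_mul]
        field_simp
        linarith
  rintro x (rfl | rfl | rfl)
  · exact ⟨0, by simp⟩
  · exact ⟨1, by simp⟩
  · simpa using key

/-- The segments from `p` to `q` and `r`, having the same slope, overlap unless `p` lies
between `q` and `r`. -/
theorem wbtw_of_lineSlope_eq {p q r : ℝ × ℝ} (hpq : p ≠ q)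
    (h : lineSlope p q = lineSlope p r) (hq : ¬ Wbtw ℝ p q r) (hr : ¬ Wbtw ℝ p r q) :
    Wbtw ℝ q p r := by
  rcases (collinear_of_lineSlope_eq hpq h).wbtw_or_wbtw_or_wbtw with h | h | h
  · exact absurd h hq
  · exact absurd h.symm hr
  · exact h.symm

theorem wbtw_total_of_wbtw_left {x y a b : ℝ × ℝ} (hxy : x ≠ y)
    (ha : Wbtw ℝ x a y) (hb : Wbtw ℝ x b y) : Wbtw ℝ x a b ∨ Wbtw ℝ x b a :=
  wbtw_total_of_sameRay_vsub_left <| ha.sameRay_vsub_left.trans hb.sameRay_vsub_left.symm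
    fun h ↦ absurd (vsub_eq_zero_iff_eq.1 h).symm hxy

/-- Every non-crossing straight-line drawing of the complete bipartite graph `K_{2,3}`
uses at least 3 distinct edge slopes. -/
theorem K23_needs_three_slopes (f : Fin 2 ⊕ Fin 3 → ℝ × ℝ)
    (hf : IsSLEmbeddingOn Set.univ (completeBipartiteGraph (Fin 2) (Fin 3)) f)
    (S : Finset ℝ)
    (hS : ∀ u v : Fin 2 ⊕ Fin 3, (completeBipartiteGraph (Fin 2) (Fin 3)).Adj u v →
      lineSlope (f u) (f v) ∈ S) :
    3 ≤ S.card := by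
  obtain ⟨hinj, hvert, -⟩ := hf
  rw [Set.injOn_univ] at hinj
  let a := f (.inl 0)
  let b := f (.inl 1)
  let c (i : Fin 3) := f (.inr i)
  have hab : a ≠ b := hinj.ne (by simp)
  have hac (i) : a ≠ c i := hinj.ne (by simp)
  have hbc (i) : b ≠ c i := hinj.ne (by simp)
  have hcc {i j} (h : i ≠ j) : c i ≠ c j := hinj.ne (by simpa using h)
  have hseg (k l i) (h : k ≠ l) : ¬ Wbtw ℝ (c i) (f (.inl k)) (f (.inl l)) := fun hw ↦ by
    simpa [h] using hvert (.inr i) (.inl l) (by simp) (.inl k) trivial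
      (mem_segment_iff_wbtw.2 hw)
  have hseg' (k i j) (h : i ≠ j) : ¬ Wbtw ℝ (f (.inl k)) (c i) (c j) := fun hw ↦ by
    simpa [h] using hvert (.inl k) (.inr j) (by simp) (.inr i) trivial
      (mem_segment_iff_wbtw.2 hw)
  let σ (i : Fin 3) := lineSlope a (c i)
  let τ (i : Fin 3) := lineSlope b (c i)
  -- The slope of the line through `a`, `b` and `c i` when these are collinear.
  have slope_ab {i} (h : σ i = τ i) : lineSlope a b = σ i := by
    have := lineSlope_eq_of_lineSlope_eq hab
      (by rwa [lineSlope_comm _ a, lineSlope_comm _ b] : lineSlope (c i) a = lineSlope (c i) b)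
    rwa [lineSlope_comm _ a] at this
  have eq_of_left {i j} (h : σ i = τ i) (hj : σ j = σ i) : σ j = τ j := by
    have := lineSlope_eq_of_lineSlope_eq (hbc j) ((slope_ab h).trans hj.symm)
    exact hj.trans ((this.trans (slope_ab h)).symm)
  have eq_of_right {i j} (h : σ i = τ i) (hj : τ j = σ i) : σ j = τ j := by
    have e : lineSlope b a = lineSlope b (c j) :=
      (lineSlope_comm b a).trans ((slope_ab h).trans hj.symm)
    exact (lineSlope_eq_of_lineSlope_eq (hac j) e).trans e
  have not_both {i j} (hij : i ≠ j) (hi : σ i = τ i) (hj : σ j = τ j) : False := by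
    have e : σ i = σ j := (slope_ab hi).symm.trans (slope_ab hj)
    have ha := wbtw_of_lineSlope_eq (hac i) e (hseg' 0 i j hij) (hseg' 0 j i hij.symm)
    have hb := wbtw_of_lineSlope_eq (hbc i) (hi.symm.trans (e.trans hj))
      (hseg' 1 i j hij) (hseg' 1 j i hij.symm)
    rcases wbtw_total_of_wbtw_left (hcc hij) ha hb with h | h
    · exact hseg 0 1 i (by simp) h
    · exact hseg 1 0 i (by simp) h
  have parallelogram {i j} (hij : i ≠ j) (hs : σ i = σ j) (ht : τ i = τ j) : σ i = τ i :=
    (lineSlope_eq_of_lineSlope_eq (hcc hij) hs).symm.trans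
      (lineSlope_eq_of_lineSlope_eq (hcc hij) ht)
  have hσ (i) : σ i ∈ S := hS _ _ (by simp)
  have hτ (i) : τ i ∈ S := hS _ _ (by simp)
  by_contra! hcard
  have hS₂ {x y z : ℝ} (hx : x ∈ S) (hy : y ∈ S) (hz : z ∈ S) : x = y ∨ x = z ∨ y = z := by
    by_contra! h
    exact hcard.not_ge (Finset.two_lt_card.2 ⟨x, hx, y, hy, z, hz, h⟩)
  have hne (i) : σ i ≠ τ i := fun hi ↦ by
    obtain ⟨j, hij⟩ := exists_ne i
    rcases hS₂ (hσ i) (hσ j) (hτ j) with h | h | h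
    · exact not_both hij.symm hi (eq_of_left hi h.symm)
    · exact not_both hij.symm hi (eq_of_right hi h.symm)
    · exact not_both hij.symm hi h
  have hσne {i j} (hij : i ≠ j) : σ i ≠ σ j := fun h ↦ by
    rcases hS₂ (hσ i) (hτ i) (hτ j) with h' | h' | h'
    · exact hne i h'
    · exact hne j (h.symm.trans h')
    · exact hne i (parallelogram hij h h')
  rcases hS₂ (hσ 0) (hσ 1) (hσ 2) with h | h | h <;> exact hσne (by decide) h
end

section
/- Let x, y, z be three noncollinear points in ℝ² such that the interior angles of the triangle xyz at y and at z are acute, and let p be the orthogonal projection of x onto the line through y and z (so p lies strictly between y and z). Then for every ε > 0 there exist a point c in the interior of the triangle xyz and a real number r > 0 such that every point v with dist(v, c) ≤ r satisfies: v lies in the interior of the triangle xyz, the angle ∠ v x p (at the vertex x) is less than ε, the angle ∠ v y p (at the vertex y) is less than ε, and the angle ∠ v z p (at the vertex z) is less than ε. -/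
open EuclideanGeometry
open scoped RealInnerProductSpace

/-- An angle smaller than a right angle has rays with positive inner product. -/
lemma inner_pos_of_angle_lt_pi_div_two {V : Type*} [NormedAddCommGroup V]
    [InnerProductSpace ℝ V] {u w : V} (h : InnerProductGeometry.angle u w < Real.pi / 2) :
    0 < ⟪u, w⟫ := by
  have hpos := Real.arccos_lt_pi_div_two.mp h
  by_contra! hle
  exact hpos.not_ge (div_nonpos_of_nonpos_of_nonneg hle (by positivity))

/-- The foot `p` of the perpendicular from `x` to the line `yz` lies in the open segment from
`y` to `z` when the angles at `y` and `z` are acute. -/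
lemma mem_openSegment_of_angle_lt_pi_div_two {V : Type*} [NormedAddCommGroup V]
    [InnerProductSpace ℝ V] {x y z p : V}
    (hy : ∠ x y z < Real.pi / 2) (hz : ∠ x z y < Real.pi / 2)
    (hp_mem : p ∈ affineSpan ℝ ({y, z} : Set V)) (hp_perp : ⟪x - p, z - y⟫ = 0) :
    p ∈ openSegment ℝ y z := by
  obtain ⟨t, rfl⟩ := mem_affineSpan_pair_iff_exists_lineMap_eq.mp hp_mem
  have hy' : 0 < ⟪x - y, z - y⟫ := inner_pos_of_angle_lt_pi_div_two hy
  have hz' : 0 < ⟪x - z, y - z⟫ := inner_pos_of_angle_lt_pi_div_two hz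
  have ht : ⟪x - y, z - y⟫ = t * ‖z - y‖ ^ 2 := by
    have : x - y = (x - AffineMap.lineMap y z t) + t • (z - y) := by
      rw [AffineMap.lineMap_apply_module']
      abel
    rw [this, inner_add_left, hp_perp, real_inner_smul_left, real_inner_self_eq_norm_sq, zero_add]
  have ht' : ⟪x - z, y - z⟫ = (1 - t) * ‖z - y‖ ^ 2 := by
    have : ⟪x - z, y - z⟫ = ⟪z - y, z - y⟫ - ⟪x - y, z - y⟫ := by
      rw [← inner_sub_left, ← neg_sub z y, inner_neg_right, ← inner_neg_left]
      congr 1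
      abel
    rw [this, ht, real_inner_self_eq_norm_sq]
    ring
  rw [openSegment_eq_image_lineMap]
  refine ⟨t, ⟨?_, ?_⟩, rfl⟩
  · exact pos_of_mul_pos_left (ht ▸ hy') (by positivity)
  · exact sub_pos.mp (pos_of_mul_pos_left (ht' ▸ hz') (by positivity))

/-- Points near `p` are seen from any `a ≠ p` at a small angle from `p`. -/
lemma eventually_angle_lt {V : Type*} [NormedAddCommGroup V] [InnerProductSpace ℝ V]
    {a p : V} (h : p ≠ a) {ε : ℝ} (hε : 0 < ε) : ∀ᶠ v in nhds p, ∠ v a p < ε := by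
  have hcont : ContinuousAt (fun v : V => ∠ v a p) p :=
    (EuclideanGeometry.continuousAt_angle (x := (p, a, p)) h h).comp
      (f := fun v : V => (v, a, p)) (by fun_prop)
  exact hcont.eventually_lt_const (by simpa [EuclideanGeometry.angle_self_of_ne h] using hε)

/-- The convex hull of a nondegenerate triangle in the plane has nonempty interior. -/
lemma interior_convexHull_triangle_nonempty {x y z : EuclideanSpace ℝ (Fin 2)}
    (h : ¬ Collinear ℝ ({x, y, z} : Set (EuclideanSpace ℝ (Fin 2)))) :
    (interior (convexHull ℝ ({x, y, z} : Set (EuclideanSpace ℝ (Fin 2))))).Nonempty := by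
  have hind := affineIndependent_iff_not_collinear_set.mpr h
  have hspan := hind.affineSpan_eq_top_iff_card_eq_finrank_add_one.mpr (by simp)
  rw [interior_convexHull_nonempty_iff_affineSpan_eq_top, ← hspan]
  simp_rw [Matrix.range_cons, Matrix.range_empty, Set.singleton_union, insert_empty_eq]

/-- Let `x y z` be a triangle (in the Euclidean plane) with acute interior angles at `y`
and `z`, and let `p` be the orthogonal projection of `x` onto the line through `y` and
`z` (characterized by `p` lying on that line and `x - p` being orthogonal to `z - y`).
Then for every `ε > 0` there are a point `c` in the interior of the triangle and a
radius `r > 0` such that every point `v` at distance at most `r` from `c` lies in the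
interior of the triangle and satisfies `∠ v x p < ε`, `∠ v y p < ε` and `∠ v z p < ε`. -/
theorem point_near_foot_of_altitude (x y z p : EuclideanSpace ℝ (Fin 2))
    (hncol : ¬ Collinear ℝ ({x, y, z} : Set (EuclideanSpace ℝ (Fin 2))))
    (hy : ∠ x y z < Real.pi / 2) (hz : ∠ x z y < Real.pi / 2)
    (hp_mem : p ∈ affineSpan ℝ ({y, z} : Set (EuclideanSpace ℝ (Fin 2))))
    (hp_perp : ⟪x - p, z - y⟫ = 0)
    (ε : ℝ) (hε : 0 < ε) :
    ∃ (c : EuclideanSpace ℝ (Fin 2)) (r : ℝ), 0 < r ∧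
      c ∈ interior (convexHull ℝ ({x, y, z} : Set (EuclideanSpace ℝ (Fin 2)))) ∧
      ∀ v : EuclideanSpace ℝ (Fin 2), dist v c ≤ r →
        v ∈ interior (convexHull ℝ ({x, y, z} : Set (EuclideanSpace ℝ (Fin 2)))) ∧
        ∠ v x p < ε ∧ ∠ v y p < ε ∧ ∠ v z p < ε := by
  have hseg := mem_openSegment_of_angle_lt_pi_div_two hy hz hp_mem hp_perp
  have hyz : y ≠ z := ne₂₃_of_not_collinear hncol
  have hpx : p ≠ x := by
    rintro rfl
    exact hncol (collinear_insert_of_mem_affineSpan_pair hp_mem)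
  have hpy : p ≠ y := by
    rintro rfl
    exact hyz (left_mem_openSegment_iff.mp hseg)
  have hpz : p ≠ z := by
    rintro rfl
    exact hyz (right_mem_openSegment_iff.mp hseg)
  set T := convexHull ℝ ({x, y, z} : Set (EuclideanSpace ℝ (Fin 2)))
  have hpT : p ∈ T :=
    (convex_convexHull ℝ _).segment_subset (subset_convexHull ℝ _ (by simp))
      (subset_convexHull ℝ _ (by simp)) (openSegment_subset_segment ℝ y z hseg)
  have hpcl : p ∈ closure (interior T) := by
    rw [(convex_convexHull ℝ _).closure_interior_eq_closure_of_nonempty_interior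
      (interior_convexHull_triangle_nonempty hncol)]
    exact subset_closure hpT
  have hev : ∀ᶠ v in nhds p, ∠ v x p < ε ∧ ∠ v y p < ε ∧ ∠ v z p < ε :=
    (eventually_angle_lt hpx hε).and ((eventually_angle_lt hpy hε).and (eventually_angle_lt hpz hε))
  obtain ⟨U, hU, hUo, hpU⟩ := eventually_nhds_iff.mp hev
  obtain ⟨c, hcU, hcT⟩ := mem_closure_iff.mp hpcl U hUo hpU
  obtain ⟨r, hr, hball⟩ := Metric.nhds_basis_closedBall.mem_iff.mp
    ((hUo.inter isOpen_interior).mem_nhds ⟨hcU, hcT⟩)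
  exact ⟨c, r, hr, hcT, fun v hv => ⟨(hball hv).2, hU v (hball hv).1⟩⟩
end
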